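/- arXiv:2511.07582 — 2 statements merged into one kernel-verified Lean document; each statement's English description precedes it below -/
import Mathlib

section
/- For every f ∈ C_c^∞(ℝ³; ℂ), Re ∫_{ℝ³} ∇\bar{f}(x) · ∇(|x|² f(x)) dx ≥ −(3/4) ∫_{ℝ³} |f(x)|² dx; equivalently, Re⟨|x|² f, −Δf⟩ ≥ −(3/4)⟨f, f⟩. -/
open MeasureTheory

noncomputable section

/-- ℝ³ as a Euclidean space. -/
abbrev E3 : Type := EuclideanSpace ℝ (Fin 3)

/-- The integral of a directional derivative of a compactly supported `C¹` function vanishes. -/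
lemma integral_fderiv_apply_eq_zero {E : Type*} [NormedAddCommGroup E] [NormedSpace ℝ E]
    [FiniteDimensional ℝ E] [MeasurableSpace E] [BorelSpace E] (μ : Measure E)
    [μ.IsAddHaarMeasure] {h : E → ℝ} (hh : ContDiff ℝ 1 h) (hc : HasCompactSupport h) (v : E) :
    ∫ x, fderiv ℝ h x v ∂μ = 0 := by
  have hcont : Continuous fun x => fderiv ℝ h x v :=
    (hh.continuous_fderiv one_ne_zero).clm_apply continuous_const
  have key := integral_mul_fderiv_eq_neg_fderiv_mul_of_integrable (μ := μ)
    (f := fun _ : E => (1 : ℝ)) (g := h) (v := v) (by simp)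
    (by simpa using hcont.integrable_of_hasCompactSupport (hc.fderiv_apply (𝕜 := ℝ) v))
    (by simpa using hh.continuous.integrable_of_hasCompactSupport hc)
    (fun _ _ => differentiableAt_const _)
    (fun x _ => hh.differentiable one_ne_zero x)
  simpa using key

lemma fderiv_norm_sq_mul_apply {f : E3 → ℂ} {x : E3} (hf : DifferentiableAt ℝ f x) (k : Fin 3) :
    fderiv ℝ (fun y : E3 => (‖y‖ ^ 2 : ℂ) * f y) x (EuclideanSpace.single k (1 : ℝ)) =
      2 * (x k : ℂ) * f x +
        (‖x‖ ^ 2 : ℂ) * fderiv ℝ f x (EuclideanSpace.single k (1 : ℝ)) := by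
  have h1 : HasFDerivAt (fun y : E3 => ‖y‖ ^ 2) _ x := (hasFDerivAt_id x).norm_sq
  have h2 := h1.smul hf.hasFDerivAt
  have h3 : (fun y : E3 => (‖y‖ ^ 2 : ℂ) * f y) = (fun y : E3 => ‖y‖ ^ 2) • f := by
    ext y; simp
  rw [h3, HasFDerivAt.fderiv h2]
  simp [EuclideanSpace.inner_single_right]
  ring

lemma fderiv_coord_mul_norm_sq_apply {f : E3 → ℂ} {x : E3} (hf : DifferentiableAt ℝ f x)
    (k : Fin 3) :
    fderiv ℝ (fun y : E3 => y k * ‖f y‖ ^ 2) x (EuclideanSpace.single k (1 : ℝ)) =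
      ‖f x‖ ^ 2 + 2 * x k * ((starRingEnd ℂ) (f x) *
        fderiv ℝ f x (EuclideanSpace.single k (1 : ℝ))).re := by
  have h1 : HasFDerivAt (fun y : E3 => y k) _ x :=
    (EuclideanSpace.proj k : E3 →L[ℝ] ℝ).hasFDerivAt
  have h2 := h1.mul hf.hasFDerivAt.norm_sq
  refine (DFunLike.congr_fun (HasFDerivAt.fderiv h2) _).trans ?_
  simp [Complex.inner]
  ring

/-- The pointwise bound `|x|²|p|² + 2 Re (w̄ (x · p)) ≥ -Re (w̄ (x · p)) - (9/4)|w|²`, obtained from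
Cauchy–Schwarz and `|x · p + (3/2) w|² ≥ 0`. -/
lemma re_sum_conj_mul_ge (x : E3) (w : ℂ) (p : Fin 3 → ℂ) :
    -(1 / 2) * ∑ k, (‖w‖ ^ 2 + 2 * x k * ((starRingEnd ℂ) w * p k).re) - 3 / 4 * ‖w‖ ^ 2 ≤
      (∑ k, (starRingEnd ℂ) (p k) * (2 * (x k : ℂ) * w + (‖x‖ ^ 2 : ℂ) * p k)).re := by
  have hx : (‖x‖ ^ 2 : ℂ) = ((x 0 ^ 2 + x 1 ^ 2 + x 2 ^ 2 : ℝ) : ℂ) := by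
    rw [← Complex.ofReal_pow, EuclideanSpace.real_norm_sq_eq, Fin.sum_univ_three]
  have cauchy (a : Fin 3 → ℝ) : (x 0 * a 0 + x 1 * a 1 + x 2 * a 2) ^ 2 ≤
      (x 0 ^ 2 + x 1 ^ 2 + x 2 ^ 2) * (a 0 ^ 2 + a 1 ^ 2 + a 2 ^ 2) := by
    nlinarith [sq_nonneg (x 0 * a 1 - x 1 * a 0), sq_nonneg (x 0 * a 2 - x 2 * a 0),
      sq_nonneg (x 1 * a 2 - x 2 * a 1)]
  have hre := cauchy fun k => (p k).re
  have him := cauchy fun k => (p k).im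
  rw [hx, Complex.sq_norm, Complex.normSq_apply]
  simp only [Fin.sum_univ_three, Complex.add_re, Complex.mul_re, Complex.add_im, Complex.mul_im,
    Complex.conj_re, Complex.conj_im, Complex.ofReal_re, Complex.ofReal_im, Complex.re_ofNat,
    Complex.im_ofNat]
  linarith [sq_nonneg (x 0 * (p 0).re + x 1 * (p 1).re + x 2 * (p 2).re + 3 / 2 * w.re),
    sq_nonneg (x 0 * (p 0).im + x 1 * (p 1).im + x 2 * (p 2).im + 3 / 2 * w.im)]

/-- For every `f ∈ C_c^∞(ℝ³; ℂ)`,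
`Re ∫ ∇f̄ · ∇(|x|² f) dx ≥ −(3/4) ∫ |f|² dx`, i.e. `Re⟨|x|² f, −Δf⟩ ≥ −(3/4)⟨f, f⟩`.
Here `∇f̄ · ∇(|x|² f) = ∑_k (∂_k f)* · ∂_k(|x|² f)` with `∂_k` the partial derivative in the
`k`-th coordinate direction. -/
theorem re_inner_x_sq_neg_laplacian_ge (f : E3 → ℂ)
    (hf : ContDiff ℝ (⊤ : ℕ∞) f) (hsupp : HasCompactSupport f) :
    (∫ x : E3, ∑ k : Fin 3,
        (starRingEnd ℂ) (fderiv ℝ f x (EuclideanSpace.single k (1 : ℝ))) *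
          fderiv ℝ (fun y : E3 => (‖y‖ ^ 2 : ℂ) * f y) x (EuclideanSpace.single k (1 : ℝ))).re
      ≥ -(3 / 4) * ∫ x : E3, ‖f x‖ ^ 2 := by
  have hf1 : ContDiff ℝ 1 f := hf.of_le (by exact_mod_cast le_top)
  have hd (x : E3) : DifferentiableAt ℝ f x := hf1.differentiable one_ne_zero x
  have hdc (k : Fin 3) : Continuous fun x => fderiv ℝ f x (EuclideanSpace.single k (1 : ℝ)) :=
    (hf1.continuous_fderiv one_ne_zero).clm_apply continuous_const
  have hfc := hf.continuous
  have hc (k : Fin 3) : ContDiff ℝ 1 fun y : E3 => y k * ‖f y‖ ^ 2 :=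
    (EuclideanSpace.proj k : E3 →L[ℝ] ℝ).contDiff.mul (hf1.norm_sq ℝ)
  have hsq : HasCompactSupport fun y : E3 => ‖f y‖ ^ 2 :=
    hsupp.comp_left (g := fun z : ℂ => ‖z‖ ^ 2) (by simp)
  have hcs (k : Fin 3) : HasCompactSupport fun y : E3 => y k * ‖f y‖ ^ 2 := hsq.mul_left
  have hzero (k : Fin 3) := integral_fderiv_apply_eq_zero volume (hc k) (hcs k)
    (EuclideanSpace.single k (1 : ℝ))
  have hint (k : Fin 3) : Integrable fun x => fderiv ℝ (fun y : E3 => y k * ‖f y‖ ^ 2) x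
      (EuclideanSpace.single k (1 : ℝ)) :=
    (((hc k).continuous_fderiv one_ne_zero).clm_apply
      continuous_const).integrable_of_hasCompactSupport ((hcs k).fderiv_apply (𝕜 := ℝ) _)
  have hsqint : Integrable fun x : E3 => ‖f x‖ ^ 2 :=
    (hfc.norm.pow 2).integrable_of_hasCompactSupport hsq
  simp_rw [fderiv_norm_sq_mul_apply (hd _)]
  have hI : Integrable fun x : E3 => ∑ k : Fin 3,
      (starRingEnd ℂ) (fderiv ℝ f x (EuclideanSpace.single k (1 : ℝ))) *
        (2 * (x k : ℂ) * f x +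
          (‖x‖ ^ 2 : ℂ) * fderiv ℝ f x (EuclideanSpace.single k (1 : ℝ))) := by
    refine integrable_finsetSum _ fun k _ => Continuous.integrable_of_hasCompactSupport ?_ ?_
    · have := hdc k
      exact (Complex.continuous_conj.comp this).mul (by fun_prop)
    · exact ((hsupp.fderiv_apply (𝕜 := ℝ) (EuclideanSpace.single k (1 : ℝ))).comp_left
        (map_zero (starRingEnd ℂ))).mul_right
  have hsum := integrable_finsetSum Finset.univ fun k _ => hint k
  calc -(3 / 4) * ∫ x : E3, ‖f x‖ ^ 2
      = ∫ x : E3, (-(1 / 2) * ∑ k : Fin 3, fderiv ℝ (fun y : E3 => y k * ‖f y‖ ^ 2) x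
          (EuclideanSpace.single k (1 : ℝ)) - 3 / 4 * ‖f x‖ ^ 2) := by
        rw [integral_sub (hsum.const_mul _) (hsqint.const_mul _), integral_const_mul,
          integral_const_mul, integral_finsetSum _ fun k _ => hint k,
          Finset.sum_eq_zero fun k _ => hzero k]
        ring
    _ ≤ ∫ x : E3, (∑ k : Fin 3,
          (starRingEnd ℂ) (fderiv ℝ f x (EuclideanSpace.single k (1 : ℝ))) *
            (2 * (x k : ℂ) * f x +
              (‖x‖ ^ 2 : ℂ) * fderiv ℝ f x (EuclideanSpace.single k (1 : ℝ)))).re := by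
        refine integral_mono ((hsum.const_mul _).sub (hsqint.const_mul _)) hI.re fun x => ?_
        simp_rw [fderiv_coord_mul_norm_sq_apply (hd x)]
        exact re_sum_conj_mul_ge x (f x) _
    _ = _ := integral_re hI
end
end

section
/- Let b > 0, a > 0 and c ≥ 0 be real numbers, and for μ > 0 let x̂(μ) denote the unique positive solution of x = μ + b/√x. Then x̂(a + c) ≤ x̂(a) + c. -/
/-- Let `b > 0`, `a > 0`, `c ≥ 0`, and for `μ > 0` let `x̂(μ)` denote the unique positive
solution of `x = μ + b/√x`. Then `x̂(a + c) ≤ x̂(a) + c`. -/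
theorem fixed_point_shift_bound (b a c xa xac : ℝ) (hb : 0 < b) (ha : 0 < a) (hc : 0 ≤ c)
    (hxa_pos : 0 < xa) (hxa : xa = a + b / Real.sqrt xa)
    (hxac_pos : 0 < xac) (hxac : xac = (a + c) + b / Real.sqrt xac) :
    xac ≤ xa + c := by
  by_contra! h
  have hle : b / Real.sqrt xac ≤ b / Real.sqrt xa :=
    div_le_div_of_nonneg_left hb.le (Real.sqrt_pos.2 hxa_pos) (Real.sqrt_le_sqrt (by linarith))
  linarith
end
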